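/- A finite connected quasi-threshold graph G has exactly two main Q-eigenvalues if and only if G is isomorphic to one of: (a) K_c ⊕ (K_a ∪ K_b) for some integers a, b, c ≥ 1 with a ≠ b; or (b) K_c ⊕ (tK_a) for some integers t ≥ 2 and a, c ≥ 1. -/

import Mathlib

open SimpleGraph

/-- The signless Laplacian matrix `Q(G) = D(G) + A(G)` of a finite simple graph. -/
noncomputable def signlessLaplacian {V : Type*} [Fintype V] (G : SimpleGraph V) :
    Matrix V V ℝ :=
  letI := Classical.decEq V
  letI := Classical.decRel G.Adj
  Matrix.diagonal (fun v => (G.degree v : ℝ)) + G.adjMatrix ℝ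

/-- `q` is a main Q-eigenvalue of `G`: some eigenvector of `Q(G)` for `q`
has nonzero entry sum. -/
def IsMainQEigenvalue {V : Type*} [Fintype V] (G : SimpleGraph V) (q : ℝ) : Prop :=
  ∃ x : V → ℝ, (signlessLaplacian G).mulVec x = q • x ∧ (∑ v, x v) ≠ 0

/-- The number of (distinct) main Q-eigenvalues of `G`. -/
noncomputable def mainQCount {V : Type*} [Fintype V] (G : SimpleGraph V) : ℕ :=
  {q : ℝ | IsMainQEigenvalue G q}.ncard

/-- `G` contains an induced copy of `H`. -/
def HasInducedCopy {α β : Type*} (H : SimpleGraph α) (G : SimpleGraph β) : Prop :=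
  ∃ f : α ↪ β, ∀ a b : α, H.Adj a b ↔ G.Adj (f a) (f b)

/-- A cograph is a `P₄`-free graph. -/
def IsCograph {V : Type*} (G : SimpleGraph V) : Prop :=
  ¬ HasInducedCopy (SimpleGraph.pathGraph 4) G

/-- A quasi-threshold graph is a `{P₄, C₄}`-free graph. -/
def IsQuasiThreshold {V : Type*} (G : SimpleGraph V) : Prop :=
  ¬ HasInducedCopy (SimpleGraph.pathGraph 4) G ∧
  ¬ HasInducedCopy (SimpleGraph.cycleGraph 4) G

/-- A chordal graph: no induced cycle of length at least 4. -/
def IsChordal {V : Type*} (G : SimpleGraph V) : Prop :=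
  ∀ n : ℕ, 4 ≤ n → ¬ HasInducedCopy (SimpleGraph.cycleGraph n) G

/-- The join `G ⊕ H` of two vertex-disjoint graphs. -/
def graphJoin {V W : Type*} (G : SimpleGraph V) (H : SimpleGraph W) :
    SimpleGraph (V ⊕ W) where
  Adj x y :=
    match x, y with
    | Sum.inl a, Sum.inl b => G.Adj a b
    | Sum.inr a, Sum.inr b => H.Adj a b
    | Sum.inl _, Sum.inr _ => True
    | Sum.inr _, Sum.inl _ => True
  symm := by
    refine ⟨?_⟩
    rintro (a | a) (b | b) h
    · exact G.adj_symm h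
    · trivial
    · trivial
    · exact H.adj_symm h
  loopless := by
    refine ⟨?_⟩
    rintro (a | a) h
    · exact G.loopless.irrefl a h
    · exact H.loopless.irrefl a h

/-- The disjoint union `G ∪ H` of two vertex-disjoint graphs. -/
def disjUnionGraph {V W : Type*} (G : SimpleGraph V) (H : SimpleGraph W) :
    SimpleGraph (V ⊕ W) where
  Adj x y :=
    match x, y with
    | Sum.inl a, Sum.inl b => G.Adj a b
    | Sum.inr a, Sum.inr b => H.Adj a b
    | _, _ => False
  symm := by
    refine ⟨?_⟩
    rintro (a | a) (b | b) h
    · exact G.adj_symm h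
    · exact h.elim
    · exact h.elim
    · exact H.adj_symm h
  loopless := by
    refine ⟨?_⟩
    rintro (a | a) h
    · exact G.loopless.irrefl a h
    · exact H.loopless.irrefl a h

/-- `tK_a`: the disjoint union of `t` copies of the complete graph `K_a`. -/
def copiesComplete (t a : ℕ) : SimpleGraph (Fin t × Fin a) where
  Adj x y := x.1 = y.1 ∧ x.2 ≠ y.2
  symm := ⟨fun _ _ ⟨h1, h2⟩ => ⟨h1.symm, h2.symm⟩⟩
  loopless := ⟨fun _ ⟨_, h⟩ => h rfl⟩

/-- The disjoint union `a₁ K_{n₁} ∪ ⋯ ∪ a_p K_{n_p}`: for each `i : Fin p`,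
`a i` copies of the complete graph on `n i` vertices. Two vertices are adjacent
iff they lie in the same copy of the same complete graph and are distinct. -/
def satellites (p : ℕ) (a n : Fin p → ℕ) :
    SimpleGraph ((i : Fin p) × (Fin (a i) × Fin (n i))) where
  Adj x y := x.1 = y.1 ∧ HEq x.2.1 y.2.1 ∧ ¬ HEq x.2.2 y.2.2
  symm := ⟨fun _ _ ⟨h1, h2, h3⟩ => ⟨h1.symm, h2.symm, fun h => h3 h.symm⟩⟩
  loopless := ⟨fun _ ⟨_, _, h3⟩ => h3 HEq.rfl⟩


noncomputable section QTaux

open Classical in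
/-- closed neighbourhood -/
def nb {V : Type*} [Fintype V] (G : SimpleGraph V) (v : V) : Finset V :=
  Finset.univ.filter (fun w => w = v ∨ G.Adj v w)

def kd {V : Type*} [Fintype V] (G : SimpleGraph V) (v : V) : ℝ := ((nb G v).card : ℝ)

def QStar {V : Type*} [Fintype V] (G : SimpleGraph V) (α β : ℝ) : Prop :=
  ∀ v, (kd G v - 2) * kd G v + ∑ w ∈ nb G v, kd G w = α * kd G v + β

theorem mem_nb {V : Type*} [Fintype V] (G : SimpleGraph V) (v w : V) :
    w ∈ nb G v ↔ w = v ∨ G.Adj v w := by simp [nb]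

theorem nb_self {V : Type*} [Fintype V] (G : SimpleGraph V) (v : V) : v ∈ nb G v := by
  simp [nb]

theorem nb_symm {V : Type*} [Fintype V] {G : SimpleGraph V} {v w : V} (h : w ∈ nb G v) :
    v ∈ nb G w := by
  rw [mem_nb] at *
  rcases h with h | h
  · exact Or.inl h.symm
  · exact Or.inr h.symm

theorem Q_mulVec {V : Type*} [Fintype V] (G : SimpleGraph V) (x : V → ℝ) (v : V) :
    (signlessLaplacian G).mulVec x v = (kd G v - 2) * x v + ∑ w ∈ nb G v, x w := by
  classical
  have hnb : nb G v = insert v (G.neighborFinset v) := by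
    ext w; simp [nb]
  have hk : kd G v = (G.degree v : ℝ) + 1 := by
    unfold kd
    rw [hnb, Finset.card_insert_of_notMem (by simp)]
    simp
  rw [hk, hnb, Finset.sum_insert (by simp)]
  unfold signlessLaplacian
  simp only [Matrix.add_mulVec, Pi.add_apply, Matrix.mulVec_diagonal,
    SimpleGraph.adjMatrix_mulVec_apply]
  have e1 : ∀ (i1 i2 : Fintype (G.neighborSet v)), @SimpleGraph.degree V G v i1 = @SimpleGraph.degree V G v i2 := by
    intro i1 i2; rw [Subsingleton.elim i1 i2]
  have e2 : ∀ (i1 i2 : Fintype (G.neighborSet v)), @SimpleGraph.neighborFinset V G v i1 = @SimpleGraph.neighborFinset V G v i2 := by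
    intro i1 i2; rw [Subsingleton.elim i1 i2]
  rw [e1 _ inferInstance, e2 _ inferInstance]
  ring

theorem Q_symm {V : Type*} [Fintype V] (G : SimpleGraph V) :
    (signlessLaplacian G).IsHermitian := by
  classical
  unfold signlessLaplacian
  apply Matrix.IsHermitian.add
  · exact Matrix.isHermitian_diagonal _
  · rw [Matrix.IsHermitian, Matrix.conjTranspose_eq_transpose_of_trivial]
    exact SimpleGraph.transpose_adjMatrix _

/-- decomposition of the all-one vector -/
theorem one_decomp {V : Type*} [Fintype V] (G : SimpleGraph V) :
    ∃ y : V → V → ℝ, ∃ l : V → ℝ, (∀ i, (signlessLaplacian G).mulVec (y i) = l i • y i) ∧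
      (∀ i, y i = 0 ∨ IsMainQEigenvalue G (l i)) ∧ (∑ i, y i) = fun _ => 1 := by
  classical
  let hQ := Q_symm G
  let b := hQ.eigenvectorBasis
  let o : EuclideanSpace ℝ V := WithLp.toLp 2 (fun _ => 1)
  refine ⟨fun i => (inner ℝ (b i) o) • (b i : EuclideanSpace ℝ V).ofLp, hQ.eigenvalues, ?_, ?_, ?_⟩
  · intro i
    rw [Matrix.mulVec_smul, hQ.mulVec_eigenvectorBasis, smul_comm]
  · intro i
    by_cases h : inner ℝ (b i) o = (0 : ℝ)
    · left; simp [h]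
    · right
      refine ⟨(b i).ofLp, hQ.mulVec_eigenvectorBasis i, ?_⟩
      intro h0
      apply h
      simp [o, PiLp.inner_apply, h0]
  · have := b.sum_repr' o
    have h2 := congrArg WithLp.ofLp this
    rw [WithLp.ofLp_sum] at h2
    simpa [o] using h2

theorem Q_one {V : Type*} [Fintype V] (G : SimpleGraph V) (v : V) :
    (signlessLaplacian G).mulVec (fun _ => 1) v = 2 * kd G v - 2 := by
  rw [Q_mulVec]; simp [kd]; ring

theorem main_one {V : Type*} [Fintype V] (G : SimpleGraph V) (q : ℝ)
    (h : ∀ r, IsMainQEigenvalue G r → r = q) (v : V) : 2 * kd G v - 2 = q := by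
  obtain ⟨y, l, h1, h2, h3⟩ := one_decomp G
  rw [← Q_one, ← h3, Matrix.mulVec_sum]
  have : ∀ i ∈ Finset.univ, (signlessLaplacian G).mulVec (y i) = q • y i := by
    intro i _
    rw [h1]
    rcases h2 i with h' | h'
    · simp [h']
    · rw [h _ h']
  rw [Finset.sum_congr rfl this, ← Finset.smul_sum, h3]
  simp

theorem main_two {V : Type*} [Fintype V] (G : SimpleGraph V) (q r : ℝ)
    (h : ∀ s, IsMainQEigenvalue G s → s = q ∨ s = r) :
    ∃ α β, QStar G α β := by
  obtain ⟨y, l, h1, h2, h3⟩ := one_decomp G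
  have key : (signlessLaplacian G).mulVec ((signlessLaplacian G).mulVec (fun _ => 1)) =
      (q + r) • (signlessLaplacian G).mulVec (fun _ => 1) - (q * r) • (fun _ => (1 : ℝ)) := by
    rw [← h3]
    simp only [Matrix.mulVec_sum, Finset.smul_sum, ← Finset.sum_sub_distrib]
    apply Finset.sum_congr rfl
    intro i _
    simp only [h1, Matrix.mulVec_smul]
    rcases h2 i with h' | h'
    · simp [h']
    · rcases h _ h' with h' | h' <;> rw [h'] <;> ext v <;> simp <;> ring
  refine ⟨q + r + 2, -(q + r) - q * r / 2 - 2, ?_⟩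
  intro v
  have hv := congrFun key v
  have e : (signlessLaplacian G).mulVec (fun _ => 1) = fun v => 2 * kd G v - 2 := by
    ext v; exact Q_one G v
  rw [e, Q_mulVec] at hv
  simp only [Finset.sum_sub_distrib, ← Finset.mul_sum, Finset.sum_const, nsmul_eq_mul,
    Pi.sub_apply, Pi.smul_apply, smul_eq_mul] at hv
  have hk : ((nb G v).card : ℝ) = kd G v := rfl
  rw [hk] at hv
  linarith

theorem main_pair {V : Type*} [Fintype V] (G : SimpleGraph V) (x y : V → ℝ) :
    ∑ v, (signlessLaplacian G).mulVec x v * y v = ∑ v, x v * (signlessLaplacian G).mulVec y v := by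
  have h : (signlessLaplacian G).transpose = signlessLaplacian G := by
    have := Q_symm G
    rwa [Matrix.IsHermitian, Matrix.conjTranspose_eq_transpose_of_trivial] at this
  have := Matrix.dotProduct_mulVec x (signlessLaplacian G) y
  rw [← Matrix.mulVec_transpose, h] at this
  exact this.symm

theorem star_count {V : Type*} [Fintype V] [Nonempty V] (G : SimpleGraph V) :
    mainQCount G = 2 ↔ (∃ α β, QStar G α β) ∧ ∃ u v, kd G u ≠ kd G v := by
  have e : (signlessLaplacian G).mulVec (fun _ => 1) = fun v => 2 * kd G v - 2 := by
    ext v; exact Q_one G v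
  have pair1 : ∀ (q : ℝ) (x : V → ℝ), (signlessLaplacian G).mulVec x = q • x →
      q * ∑ v, x v = 2 * ∑ v, x v * kd G v - 2 * ∑ v, x v := by
    intro q x hx
    have := main_pair G x (fun _ => 1)
    rw [e, hx] at this
    simp only [Pi.smul_apply, smul_eq_mul, mul_one, ← Finset.mul_sum] at this
    rw [this, Finset.mul_sum, Finset.mul_sum, ← Finset.sum_sub_distrib]
    exact Finset.sum_congr rfl (fun _ _ => by ring)
  constructor
  · intro h
    obtain ⟨q, r, hqr, hs⟩ := Set.ncard_eq_two.mp h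
    refine ⟨main_two G q r ?_, ?_⟩
    · intro s hs'
      have : s ∈ {q : ℝ | IsMainQEigenvalue G q} := hs'
      rw [hs] at this
      simpa using this
    · by_contra hc
      push Not at hc
      obtain ⟨v0⟩ := ‹Nonempty V›
      have key : ∀ s, IsMainQEigenvalue G s → s = 2 * kd G v0 - 2 := by
        rintro s ⟨x, hx, hx0⟩
        have := pair1 s x hx
        have h2 : ∑ v, x v * kd G v = (∑ v, x v) * kd G v0 := by
          rw [Finset.sum_mul]
          exact Finset.sum_congr rfl (fun v _ => by rw [hc v v0])
        rw [h2] at this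
        apply mul_right_cancel₀ hx0
        linarith
      have hq : IsMainQEigenvalue G q := by
        have : q ∈ {q : ℝ | IsMainQEigenvalue G q} := by rw [hs]; simp
        exact this
      have hr : IsMainQEigenvalue G r := by
        have : r ∈ {q : ℝ | IsMainQEigenvalue G q} := by rw [hs]; simp
        exact this
      exact hqr ((key q hq).trans (key r hr).symm)
  · rintro ⟨⟨α, β, hst⟩, u, v, huv⟩
    have quad : ∀ s, IsMainQEigenvalue G s → (s + 2) * s = α * (s + 2) + 2 * β := by
      rintro s ⟨x, hx, hx0⟩
      have h1 := pair1 s x hx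
      have h2 := main_pair G x (kd G)
      have e2 : (signlessLaplacian G).mulVec (kd G) = fun v => α * kd G v + β := by
        ext v; rw [Q_mulVec]; exact hst v
      rw [e2, hx] at h2
      have h3 : ∑ v, x v * (α * kd G v + β) = α * ∑ v, x v * kd G v + β * ∑ v, x v := by
        rw [Finset.mul_sum, Finset.mul_sum, ← Finset.sum_add_distrib]
        exact Finset.sum_congr rfl (fun _ _ => by ring)
      have h4 : ∑ v, (s • x) v * kd G v = s * ∑ v, x v * kd G v := by
        rw [Finset.mul_sum]
        exact Finset.sum_congr rfl (fun _ _ => by simp; ring)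
      rw [h3, h4] at h2
      apply mul_right_cancel₀ hx0
      linear_combination (s - α) * h1 + 2 * h2
    have one : ∃ q, IsMainQEigenvalue G q := by
      by_contra hc
      push Not at hc
      have h1 := main_one G 0 (fun r hr => (hc r hr).elim)
      exact huv (by linarith [h1 u, h1 v])
    obtain ⟨q, hq⟩ := one
    have two : ∃ r, IsMainQEigenvalue G r ∧ r ≠ q := by
      by_contra hc
      push Not at hc
      have h1 := main_one G q hc
      exact huv (by linarith [h1 u, h1 v])
    obtain ⟨r, hr, hrq⟩ := two
    have : {q : ℝ | IsMainQEigenvalue G q} = {q, r} := by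
      ext s
      simp only [Set.mem_ofPred_eq, Set.mem_insert_iff, Set.mem_singleton_iff]
      constructor
      · intro hs
        have a1 := quad s hs
        have a2 := quad q hq
        have a3 := quad r hr
        by_contra hc
        push Not at hc
        have b1 : s + q + 2 - α = 0 := by
          apply mul_left_cancel₀ (sub_ne_zero.mpr hc.1)
          linear_combination a1 - a2
        have b2 : r + q + 2 - α = 0 := by
          apply mul_left_cancel₀ (sub_ne_zero.mpr hrq)
          linear_combination a3 - a2
        exact hc.2 (by linarith)
      · rintro (rfl | rfl) <;> assumption
    unfold mainQCount
    rw [this, Set.ncard_pair hrq.symm]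

end QTaux

section QTcomb

variable {V : Type*} [Fintype V] {G : SimpleGraph V}

theorem nested (h : IsQuasiThreshold G) (u z : V) (huz : z ∈ nb G u) :
    nb G u ⊆ nb G z ∨ nb G z ⊆ nb G u := by
  by_contra hc
  push Not at hc
  obtain ⟨h1, h2⟩ := hc
  obtain ⟨y, hy1, hy2⟩ := Finset.not_subset.mp h1
  obtain ⟨w, hw1, hw2⟩ := Finset.not_subset.mp h2
  rw [mem_nb] at *
  push Not at hy2 hw2
  have huz' : G.Adj u z := by
    rcases huz with rfl | h
    · rcases hy1 with rfl | h'
      · exact (hy2.1 rfl).elim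
      · exact (hy2.2 h').elim
    · exact h
  have huy : G.Adj u y := by
    rcases hy1 with rfl | h'
    · exact (hy2.2 huz'.symm).elim
    · exact h'
  have hzw : G.Adj z w := by
    rcases hw1 with rfl | h'
    · exact (hw2.2 huz').elim
    · exact h'
  have hyw : y ≠ w := by
    rintro rfl; exact hy2.2 hzw
  -- path y u z w
  have hinj : Function.Injective ![y, u, z, w] := by
    intro i j hij
    fin_cases i <;> fin_cases j <;> simp at hij ⊢
    · exact huy.ne hij.symm
    · exact hy2.1 hij
    · exact hyw hij
    · exact huy.ne hij
    · exact huz'.ne hij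
    · exact hw2.1 hij.symm
    · exact hy2.1 hij.symm
    · exact huz'.ne hij.symm
    · exact hzw.ne hij
    · exact hyw hij.symm
    · exact hw2.1 hij
    · exact hzw.ne hij.symm
  have n1 : ¬ G.Adj z y := hy2.2
  have n2 : ¬ G.Adj u w := hw2.2
  by_cases hyw' : G.Adj y w
  · apply h.2
    refine ⟨⟨_, hinj⟩, ?_⟩
    intro a b
    fin_cases a <;> fin_cases b <;>
      simp [SimpleGraph.cycleGraph_adj, huz', huz'.symm, huy, huy.symm, hzw, hzw.symm, n1, n2,
        mt G.adj_symm n1, mt G.adj_symm n2, hyw', hyw'.symm] <;> decide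
  · apply h.1
    refine ⟨⟨_, hinj⟩, ?_⟩
    intro a b
    fin_cases a <;> fin_cases b <;>
      simp [SimpleGraph.pathGraph_adj, huz', huz'.symm, huy, huy.symm, hzw, hzw.symm, n1, n2,
        mt G.adj_symm n1, mt G.adj_symm n2, hyw', mt G.adj_symm hyw']

/-- dominating vertex -/
theorem exists_dom (hN : ∀ u z, z ∈ nb G u → nb G u ⊆ nb G z ∨ nb G z ⊆ nb G u)
    (hc : G.Connected) : ∃ u, nb G u = Finset.univ := by
  classical
  have := hc.nonempty
  obtain ⟨u, -, hu⟩ := Finset.exists_max_image Finset.univ (fun v => (nb G v).card)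
    Finset.univ_nonempty
  refine ⟨u, ?_⟩
  have step : ∀ z ∈ nb G u, nb G z ⊆ nb G u := by
    intro z hz
    rcases hN u z hz with h | h
    · rw [Finset.eq_of_subset_of_card_le h (hu z (Finset.mem_univ _))]
    · exact h
  ext w
  simp only [Finset.mem_univ, iff_true]
  obtain ⟨p⟩ := hc.preconnected u w
  have : ∀ (a b : V) (p : G.Walk a b), a ∈ nb G u → b ∈ nb G u := by
    intro a b p
    induction p with
    | nil => exact id
    | cons h p ih =>
      intro ha
      exact ih (step _ ha ((mem_nb _ _ _).mpr (Or.inr h)))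
  exact this u w p (nb_self G u)

def IsRt (G : SimpleGraph V) (u : V) : Prop :=
  nb G u ≠ Finset.univ ∧ ∀ w ∈ nb G u, nb G w ≠ Finset.univ → nb G w ⊆ nb G u

theorem exists_root (hN : ∀ u z, z ∈ nb G u → nb G u ⊆ nb G z ∨ nb G z ⊆ nb G u)
    (v : V) (hv : nb G v ≠ Finset.univ) : ∃ u, IsRt G u ∧ v ∈ nb G u := by
  classical
  obtain ⟨u, hu1, hu⟩ := Finset.exists_max_image
    ((nb G v).filter (fun w => nb G w ≠ Finset.univ)) (fun v => (nb G v).card)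
    ⟨v, by simp [hv, nb_self]⟩
  rw [Finset.mem_filter] at hu1
  refine ⟨u, ⟨hu1.2, ?_⟩, nb_symm hu1.1⟩
  intro w hw hwn
  rcases hN u w hw with h | h
  · have hvw : v ∈ nb G w := h (nb_symm hu1.1)
    rw [Finset.eq_of_subset_of_card_le h (hu w (by simp [hwn, nb_symm hvw]))]
  · exact h

theorem compare [DecidableEq V] {α β : ℝ} (hs : QStar G α β) (u v : V) (h : nb G v ⊆ nb G u) :
    α * (kd G u - kd G v) = (kd G u - kd G v) * (kd G u + kd G v - 2)
      + ∑ w ∈ (nb G u).filter (fun w => w ∉ nb G v), kd G w := by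
  have h1 := hs u
  have h2 := hs v
  have h3 : ∑ w ∈ nb G u, kd G w = ∑ w ∈ nb G v, kd G w +
      ∑ w ∈ (nb G u).filter (fun w => w ∉ nb G v), kd G w := by
    rw [← Finset.sum_filter_add_sum_filter_not (nb G u) (fun w => w ∈ nb G v)]
    congr 2
    ext w; simp only [Finset.mem_filter]; exact ⟨fun h => h.2, fun h' => ⟨h h', h'⟩⟩
  linear_combination h2 - h1 + h3

theorem card_diff [DecidableEq V] (u v : V) (h : nb G v ⊆ nb G u) :
    (((nb G u).filter (fun w => w ∉ nb G v)).card : ℝ) = kd G u - kd G v := by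
  have h3 : (nb G u).card = (nb G v).card +
      ((nb G u).filter (fun w => w ∉ nb G v)).card := by
    rw [← Finset.card_filter_add_card_filter_not (s := nb G u) (fun w => w ∈ nb G v)]
    congr 2
    ext w; simp only [Finset.mem_filter]; exact ⟨fun h => h.2, fun h' => ⟨h h', h'⟩⟩
  unfold kd
  rw [h3]; push_cast; ring

noncomputable def CC (G : SimpleGraph V) : Finset V := by
  classical exact Finset.univ.filter (fun v => nb G v = Finset.univ)

theorem mem_CC (v : V) : v ∈ CC G ↔ nb G v = Finset.univ := by simp [CC]

theorem CC_sub (v : V) : CC G ⊆ nb G v := by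
  intro w hw
  rw [mem_CC] at hw
  exact nb_symm (by rw [hw]; simp)

theorem kd_ge (v : V) (hv : nb G v ≠ Finset.univ) : ((CC G).card : ℝ) + 1 ≤ kd G v := by
  have : CC G ⊂ nb G v := by
    refine ⟨CC_sub v, fun h => hv ?_⟩
    exact (mem_CC v).mp (h (nb_self G v))
  have := Finset.card_lt_card this
  unfold kd
  exact_mod_cast this

theorem kd_le_n (v : V) : kd G v ≤ Fintype.card V := by
  unfold kd; exact_mod_cast Finset.card_le_univ _

theorem kd_mono {u v : V} (h : nb G v ⊆ nb G u) : kd G v ≤ kd G u := by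
  unfold kd; exact_mod_cast Finset.card_le_card h

theorem kd_lt {u v : V} (h : nb G v ⊆ nb G u) (hne : nb G v ≠ nb G u) : kd G v + 1 ≤ kd G u := by
  unfold kd; exact_mod_cast Finset.card_lt_card (h.ssubset_of_ne hne)

theorem kd_dom {z : V} (hz : nb G z = Finset.univ) : kd G z = Fintype.card V := by
  unfold kd; rw [hz]; simp

/-- small root components are cliques -/
theorem small_clique {α β : ℝ} (hs : QStar G α β) (z : V) (hz : nb G z = Finset.univ)
    (u : V) (hu : IsRt G u)
    (hsm : kd G u - (CC G).card ≤ Fintype.card V - kd G u) (v : V) (hv : v ∈ nb G u)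
    (hvn : nb G v ≠ Finset.univ) : nb G v = nb G u := by
  classical
  by_contra hne
  have hsub := hu.2 v hv hvn
  have hlt := kd_lt hsub hne
  have c1 := compare hs u v hsub
  have d1 := card_diff u v hsub
  have c2 := compare hs z u (by rw [hz]; simp)
  have d2 := card_diff z u (by rw [hz]; simp)
  have b1 : ∑ w ∈ (nb G u).filter (fun w => w ∉ nb G v), kd G w ≤ (kd G u - kd G v) * kd G u := by
    rw [← d1, ← nsmul_eq_mul]
    apply Finset.sum_le_card_nsmul
    intro w hw
    rw [Finset.mem_filter] at hw
    apply kd_mono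
    apply hu.2 w hw.1
    intro hw'
    exact hw.2 (CC_sub v ((mem_CC w).mpr hw'))
  have b2 : (kd G z - kd G u) * ((CC G).card + 1) ≤
      ∑ w ∈ (nb G z).filter (fun w => w ∉ nb G u), kd G w := by
    rw [← d2, ← nsmul_eq_mul]
    apply Finset.card_nsmul_le_sum
    intro w hw
    rw [Finset.mem_filter] at hw
    apply kd_ge
    intro hw'
    exact hw.2 (CC_sub u ((mem_CC w).mpr hw'))
  have hlt2 : kd G u + 1 ≤ kd G z := kd_lt (by rw [hz]; simp) (by rw [hz]; exact hu.1)
  have hzn := kd_dom hz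
  have a1 : α ≤ 2 * kd G u + kd G v - 2 := by
    have : 0 < kd G u - kd G v := by linarith
    apply le_of_mul_le_mul_left _ this
    nlinarith
  have a2 : (CC G).card + 1 + kd G z + kd G u - 2 ≤ α := by
    have : 0 < kd G z - kd G u := by linarith
    apply le_of_mul_le_mul_left _ this
    nlinarith
  linarith

theorem pair_roots {α β : ℝ} (hs : QStar G α β) (z : V) (hz : nb G z = Finset.univ)
    (u v : V) (hu : IsRt G u) (hv : IsRt G v) (huv : v ∉ nb G u) (hle : kd G v ≤ kd G u) :
    (∀ w ∈ nb G u, nb G w ≠ Finset.univ → nb G w = nb G u) ∧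
    (∀ w ∈ nb G v, nb G w ≠ Finset.univ → nb G w = nb G v) ∧
    (kd G u = kd G v ∨ ∀ w, w ∈ nb G u ∨ w ∈ nb G v) := by
  classical
  have hint : ∀ w, w ∈ nb G u → w ∈ nb G v → w ∈ CC G := by
    intro w h1 h2
    rw [mem_CC]
    by_contra hw
    exact huv (hu.2 w h1 hw (nb_symm h2))
  -- partition of V
  set A := (nb G u).filter (fun w => w ∉ CC G) with hA
  set B := (nb G v).filter (fun w => w ∉ CC G) with hB
  set R := Finset.univ.filter (fun w => w ∉ nb G u ∧ w ∉ nb G v) with hR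
  have e1 : (nb G z).filter (fun w => w ∉ nb G u) = B ∪ R := by
    ext w
    simp only [hz, hB, hR, Finset.mem_filter, Finset.mem_univ, true_and, Finset.mem_union]
    have := hint w
    have := @CC_sub _ _ G u w
    tauto
  have e2 : (nb G z).filter (fun w => w ∉ nb G v) = A ∪ R := by
    ext w
    simp only [hz, hA, hR, Finset.mem_filter, Finset.mem_univ, true_and, Finset.mem_union]
    have := hint w
    have := @CC_sub _ _ G v w
    tauto
  have dj1 : Disjoint B R := by
    rw [Finset.disjoint_left]; intro w; simp only [hB, hR, Finset.mem_filter]; tauto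
  have dj2 : Disjoint A R := by
    rw [Finset.disjoint_left]; intro w; simp only [hA, hR, Finset.mem_filter]; tauto
  have cA : (A.card : ℝ) = kd G u - (CC G).card := by
    have := card_diff (G := G) z u (by rw [hz]; simp)
    have h := Finset.card_filter_add_card_filter_not (s := nb G u) (fun w => w ∈ CC G)
    have h' : (nb G u).filter (fun w => w ∈ CC G) = CC G := by
      ext w; simp only [Finset.mem_filter]; exact ⟨fun h => h.2, fun h => ⟨CC_sub u h, h⟩⟩
    rw [h'] at h
    unfold kd; rw [← h]; push_cast; ring
  have cB : (B.card : ℝ) = kd G v - (CC G).card := by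
    have h := Finset.card_filter_add_card_filter_not (s := nb G v) (fun w => w ∈ CC G)
    have h' : (nb G v).filter (fun w => w ∈ CC G) = CC G := by
      ext w; simp only [Finset.mem_filter]; exact ⟨fun h => h.2, fun h => ⟨CC_sub v h, h⟩⟩
    rw [h'] at h
    unfold kd; rw [← h]; push_cast; ring
  have d1 := card_diff (G := G) z u (by rw [hz]; simp)
  have d2 := card_diff (G := G) z v (by rw [hz]; simp)
  have c1 := compare hs z u (by rw [hz]; simp)
  have c2 := compare hs z v (by rw [hz]; simp)
  rw [e1, Finset.card_union_of_disjoint dj1] at d1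
  rw [e2, Finset.card_union_of_disjoint dj2] at d2
  rw [e1, Finset.sum_union dj1] at c1
  rw [e2, Finset.sum_union dj2] at c2
  push_cast at d1 d2
  have hzn := kd_dom hz
  have hR0 : (0:ℝ) ≤ R.card := Nat.cast_nonneg _
  have clv : ∀ w ∈ nb G v, nb G w ≠ Finset.univ → nb G w = nb G v := by
    apply small_clique hs z hz v hv
    rw [← hzn]; linarith
  have sB : ∑ w ∈ B, kd G w = B.card * kd G v := by
    rw [← nsmul_eq_mul]
    apply Finset.sum_eq_card_nsmul
    intro w hw
    simp only [hB, Finset.mem_filter, mem_CC] at hw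
    unfold kd; rw [clv w hw.1 hw.2]
  have lA : ∀ w ∈ A, kd G w ≤ kd G u := by
    intro w hw
    simp only [hA, Finset.mem_filter, mem_CC] at hw
    exact kd_mono (hu.2 w hw.1 hw.2)
  have sA : ∑ w ∈ A, (kd G u - kd G w) = A.card * kd G u - ∑ w ∈ A, kd G w := by
    rw [Finset.sum_sub_distrib, Finset.sum_const, nsmul_eq_mul]
  have sR : (R.card : ℝ) * ((CC G).card + 1) ≤ ∑ w ∈ R, kd G w := by
    rw [← nsmul_eq_mul]
    apply Finset.card_nsmul_le_sum
    intro w hw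
    simp only [hR, Finset.mem_filter] at hw
    apply kd_ge
    intro hw'
    exact hw.2.1 (CC_sub u ((mem_CC w).mpr hw'))
  have gu := kd_ge u hu.1
  have gv := kd_ge v hv.1
  set p : ℝ := (A.card : ℝ)
  set q : ℝ := (B.card : ℝ)
  set r : ℝ := (R.card : ℝ)
  set c : ℝ := ((CC G).card : ℝ)
  set S := ∑ w ∈ R, kd G w
  set ε := ∑ w ∈ A, (kd G u - kd G w) with hε
  have hε0 : 0 ≤ ε := Finset.sum_nonneg (fun w hw => by linarith [lA w hw])
  have ku : kd G u = c + p := by linarith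
  have kv : kd G v = c + q := by linarith
  have kz : kd G z = c + p + q + r := by linarith
  have sA' : ∑ w ∈ A, kd G w = p * (c + p) - ε := by rw [ku] at sA; linarith
  rw [sB, ku, kv, kz] at c1
  rw [sA', kv, kz] at c2
  have ident : (p - q) * (r ^ 2 + (S - c * r)) + ε * (q + r) = 0 := by
    linear_combination (q + r) * c2 - (p + r) * c1
  have hpq : 0 ≤ p - q := by linarith
  have hS : r ≤ S - c * r := by linarith
  have hq : 1 ≤ q := by linarith
  have t1 : 0 ≤ (p - q) * (r ^ 2 + (S - c * r)) := mul_nonneg hpq (by nlinarith [sq_nonneg r])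
  have t2 : 0 ≤ ε * (q + r) := mul_nonneg hε0 (by linarith)
  have z2 : ε = 0 := by
    have : ε * (q + r) = 0 := by linarith
    rcases mul_eq_zero.mp this with h | h
    · exact h
    · linarith
  have z1 : (p - q) * (r ^ 2 + (S - c * r)) = 0 := by linarith
  refine ⟨?_, clv, ?_⟩
  · intro w hw hwn
    have hw' : w ∈ A := by simp only [hA, Finset.mem_filter, mem_CC]; exact ⟨hw, hwn⟩
    have := (Finset.sum_eq_zero_iff_of_nonneg (fun w hw => by linarith [lA w hw])).mp z2 w hw'
    by_contra hne
    have := kd_lt (hu.2 w hw hwn) hne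
    linarith
  · rcases mul_eq_zero.mp z1 with h | h
    · left; linarith
    · right
      have hr : r = 0 := le_antisymm (by linarith [sq_nonneg r]) hR0
      have hr' : R = ∅ := by
        rw [← Finset.card_eq_zero]; exact Nat.cast_eq_zero.mp hr
      intro w
      by_contra hw
      push Not at hw
      have : w ∈ R := by simp only [hR, Finset.mem_filter, Finset.mem_univ, true_and]; exact hw
      rw [hr'] at this
      simp at this

theorem structure_of_star {α β : ℝ} (hqt : IsQuasiThreshold G) (hc : G.Connected)
    (hs : QStar G α β) :
    (∃ z, nb G z = Finset.univ) ∧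
    (∀ u v, nb G u ≠ Finset.univ → nb G v ≠ Finset.univ → v ∈ nb G u → nb G v = nb G u) ∧
    (∀ u v, nb G u ≠ Finset.univ → nb G v ≠ Finset.univ → v ∉ nb G u →
      kd G u = kd G v ∨ ∀ w, w ∈ nb G u ∨ w ∈ nb G v) := by
  have hN := nested hqt
  obtain ⟨z, hz⟩ := exists_dom hN hc
  have cl : ∀ u, IsRt G u → ∀ w ∈ nb G u, nb G w ≠ Finset.univ → nb G w = nb G u := by
    intro u hu
    obtain ⟨w, hw⟩ : ∃ w, w ∉ nb G u := by
      by_contra h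
      push Not at h
      exact hu.1 (Finset.eq_univ_of_forall h)
    have hwn : nb G w ≠ Finset.univ := by
      intro h; exact hw (nb_symm (by rw [h]; simp))
    obtain ⟨v, hv, hwv⟩ := exists_root hN w hwn
    have huv : v ∉ nb G u := fun h => hw (hu.2 v h hv.1 hwv)
    rcases le_total (kd G v) (kd G u) with h | h
    · exact (pair_roots hs z hz u v hu hv huv h).1
    · exact (pair_roots hs z hz v u hv hu (fun h => huv (nb_symm h)) h).2.1
  have rt : ∀ u, nb G u ≠ Finset.univ → IsRt G u := by
    intro u hu
    obtain ⟨v, hv, huv⟩ := exists_root hN u hu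
    have := cl v hv u huv hu
    unfold IsRt at *
    rw [this]; exact hv
  refine ⟨⟨z, hz⟩, ?_, ?_⟩
  · intro u v hu hv huv
    exact cl u (rt u hu) v huv hv
  · intro u v hu hv huv
    rcases le_total (kd G v) (kd G u) with h | h
    · exact (pair_roots hs z hz u v (rt u hu) (rt v hv) huv h).2.2
    · rcases (pair_roots hs z hz v u (rt v hv) (rt u hu) (fun h => huv (nb_symm h)) h).2.2 with h | h
      · exact Or.inl h.symm
      · exact Or.inr fun w => (h w).symm

end QTcomb

section QTiso

def RR {κ : Type*} (a b : Option κ) : Prop := a = b ∨ a = none ∨ b = none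

theorem iso_of_label {V W L : Type*} [Fintype V] [Fintype W] [DecidableEq L]
    (G : SimpleGraph V) (H : SimpleGraph W) (l : V → L) (m : W → L) (R : L → L → Prop)
    (hG : ∀ x y, G.Adj x y ↔ x ≠ y ∧ R (l x) (l y))
    (hH : ∀ x y, H.Adj x y ↔ x ≠ y ∧ R (m x) (m y))
    (hcard : ∀ k, (Finset.univ.filter (fun x => l x = k)).card =
      (Finset.univ.filter (fun y => m y = k)).card) : Nonempty (G ≃g H) := by
  have he : ∀ k, Nonempty ({x // l x = k} ≃ {y // m y = k}) := by
    intro k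
    rw [← Fintype.card_eq, Fintype.card_subtype, Fintype.card_subtype]
    exact hcard k
  let e : V ≃ W := Equiv.ofFiberEquiv (fun k => (he k).some)
  have hm : ∀ x, m (e x) = l x := fun x => Equiv.ofFiberEquiv_map _ x
  refine ⟨⟨e, ?_⟩⟩
  intro x y
  rw [hG, hH, hm, hm]
  simp

def labB (c t a : ℕ) {κ : Type*} (f : Fin t → κ) : Fin c ⊕ (Fin t × Fin a) → Option κ :=
  Sum.elim (fun _ => none) (fun x => some (f x.1))

def labA (c a b : ℕ) : Fin c ⊕ (Fin a ⊕ Fin b) → Option Bool :=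
  Sum.elim (fun _ => none) (Sum.elim (fun _ => some true) (fun _ => some false))

theorem fibc (t a : ℕ) (i : Fin t) :
    (Finset.univ.filter (fun x : Fin t × Fin a => x.1 = i)).card = a := by
  rw [Finset.card_filter, Fintype.sum_prod_type, Finset.sum_comm]
  simp

theorem fibc' (t a : ℕ) (i : Fin t) :
    (Finset.univ.filter (fun x : Fin t × Fin a => i = x.1)).card = a := by
  simp only [eq_comm (a := i)]; exact fibc t a i

theorem adjB (c t a : ℕ) {κ : Type*} (f : Fin t → κ) (hf : Function.Injective f) (x y) :
    (graphJoin (⊤ : SimpleGraph (Fin c)) (copiesComplete t a)).Adj x y ↔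
      x ≠ y ∧ RR (labB c t a f x) (labB c t a f y) := by
  rcases x with x | ⟨x, x'⟩ <;> rcases y with y | ⟨y, y'⟩ <;>
    simp [graphJoin, copiesComplete, RR, labB, hf.eq_iff]
  tauto

theorem adjA (c a b : ℕ) (x y) :
    (graphJoin (⊤ : SimpleGraph (Fin c))
      (disjUnionGraph (⊤ : SimpleGraph (Fin a)) (⊤ : SimpleGraph (Fin b)))).Adj x y ↔
      x ≠ y ∧ RR (labA c a b x) (labA c a b y) := by
  rcases x with x | x | x <;> rcases y with y | y | y <;>
    simp [graphJoin, disjUnionGraph, RR, labA]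

theorem sum_nb_lab {V κ : Type*} [Fintype V] [DecidableEq κ] (G : SimpleGraph V) (l : V → Option κ)
    (hG : ∀ x y, G.Adj x y ↔ x ≠ y ∧ RR (l x) (l y)) (f : V → ℝ) (v : V) :
    ∑ w ∈ nb G v, f w = ∑ w, if (l v = l w ∨ l v = none ∨ l w = none) then f w else 0 := by
  classical
  rw [← Finset.sum_filter]
  apply Finset.sum_congr _ (fun _ _ => rfl)
  ext w
  rw [mem_nb, hG]
  simp only [Finset.mem_filter, Finset.mem_univ, true_and]
  by_cases h : w = v
  · simp [h]
  · simp [h, Ne.symm h, RR]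

theorem kd_eq_sum {V : Type*} [Fintype V] (G : SimpleGraph V) (v : V) :
    kd G v = ∑ w ∈ nb G v, (1:ℝ) := by simp [kd]

theorem transport {V W : Type*} [Fintype V] [Fintype W] (G : SimpleGraph V) (H : SimpleGraph W)
    (e : G ≃g H) (h : (∃ α β, QStar H α β) ∧ ∃ u v, kd H u ≠ kd H v) :
    (∃ α β, QStar G α β) ∧ ∃ u v, kd G u ≠ kd G v := by
  classical
  have h1 : ∀ v, nb H (e v) = (nb G v).map e.toEquiv.toEmbedding := by
    intro v
    ext w
    obtain ⟨w, rfl⟩ := e.surjective w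
    have : e w ∈ (nb G v).map e.toEquiv.toEmbedding ↔ w ∈ nb G v := by
      exact Finset.mem_map' e.toEquiv.toEmbedding
    rw [this, mem_nb, mem_nb, e.map_adj_iff, e.injective.eq_iff]
  have h2 : ∀ v, kd H (e v) = kd G v := by
    intro v; unfold kd; rw [h1]; simp
  obtain ⟨⟨α, β, hs⟩, u, v, huv⟩ := h
  refine ⟨⟨α, β, ?_⟩, e.symm u, e.symm v, ?_⟩
  · intro v
    have := hs (e v)
    rw [h2, h1, Finset.sum_map] at this
    have h3 : ∑ x ∈ nb G v, kd H (e.toEquiv.toEmbedding x) = ∑ x ∈ nb G v, kd G x :=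
      Finset.sum_congr rfl (fun x _ => h2 x)
    rw [h3] at this
    exact this
  · rw [← h2, ← h2]; simpa using huv

theorem starA (a b c : ℕ) (ha : 1 ≤ a) (hb : 1 ≤ b) (hc : 1 ≤ c) :
    let H := graphJoin (⊤ : SimpleGraph (Fin c))
      (disjUnionGraph (⊤ : SimpleGraph (Fin a)) (⊤ : SimpleGraph (Fin b)))
    (∃ α β, QStar H α β) ∧ ∃ u v, kd H u ≠ kd H v := by
  intro H
  have hs := sum_nb_lab H (labA c a b) (adjA c a b)
  have k1 : ∀ i, kd H (Sum.inl i) = c + (a + b) := by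
    intro i; rw [kd_eq_sum, hs, Fintype.sum_sum_type, Fintype.sum_sum_type]; simp [labA]
  have k2 : ∀ i, kd H (Sum.inr (Sum.inl i)) = c + a := by
    intro i; rw [kd_eq_sum, hs, Fintype.sum_sum_type, Fintype.sum_sum_type]; simp [labA]
  have k3 : ∀ i, kd H (Sum.inr (Sum.inr i)) = c + b := by
    intro i; rw [kd_eq_sum, hs, Fintype.sum_sum_type, Fintype.sum_sum_type]; simp [labA]
  refine ⟨⟨2 * a + 2 * b + 3 * c - 2, c * (a + b + c) - 2 * (a + c) * (b + c), ?_⟩, ?_⟩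
  · rintro (i | i | i) <;> rw [hs, Fintype.sum_sum_type, Fintype.sum_sum_type] <;> simp [labA, k1, k2, k3] <;> ring
  · refine ⟨Sum.inl ⟨0, hc⟩, Sum.inr (Sum.inl ⟨0, ha⟩), ?_⟩
    rw [k1, k2]
    have : (1:ℝ) ≤ b := by exact_mod_cast hb
    intro h; linarith

theorem starB (t a c : ℕ) (ht : 2 ≤ t) (ha : 1 ≤ a) (hc : 1 ≤ c) :
    let H := graphJoin (⊤ : SimpleGraph (Fin c)) (copiesComplete t a)
    (∃ α β, QStar H α β) ∧ ∃ u v, kd H u ≠ kd H v := by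
  intro H
  have hs := sum_nb_lab H (labB c t a id) (adjB c t a id Function.injective_id)
  have k1 : ∀ i, kd H (Sum.inl i) = c + t * a := by
    intro i; rw [kd_eq_sum, hs, Fintype.sum_sum_type]; simp [labB]
  have k2 : ∀ i, kd H (Sum.inr i) = c + a := by
    intro i; rw [kd_eq_sum, hs, Fintype.sum_sum_type]; simp [labB, fibc, fibc']
  refine ⟨⟨(c + t * a) + 2 * (c + a) - 2,
    -(c + a)^2 + c * (c + t * a) + a * (c + a) - (c + t * a) * (c + a), ?_⟩, ?_⟩
  · rintro (i | i) <;> rw [hs, Fintype.sum_sum_type] <;> simp [labB, k1, k2, fibc, fibc', Finset.sum_ite] <;> ring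
  · refine ⟨Sum.inl ⟨0, hc⟩, Sum.inr (⟨0, by omega⟩, ⟨0, ha⟩), ?_⟩
    rw [k1, k2]
    have : (1:ℝ) ≤ a := by exact_mod_cast ha
    have : (2:ℝ) ≤ t := by exact_mod_cast ht
    intro h; nlinarith

theorem iso_cases {V : Type*} [Fintype V] (G : SimpleGraph V)
    (hz : ∃ z, nb G z = Finset.univ)
    (h1 : ∀ u v, nb G u ≠ Finset.univ → nb G v ≠ Finset.univ → v ∈ nb G u → nb G v = nb G u)
    (h2 : ∀ u v, nb G u ≠ Finset.univ → nb G v ≠ Finset.univ → v ∉ nb G u →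
      kd G u = kd G v ∨ ∀ w, w ∈ nb G u ∨ w ∈ nb G v)
    (h3 : ∃ u v, kd G u ≠ kd G v) :
      ((∃ a b c : ℕ, 1 ≤ a ∧ 1 ≤ b ∧ 1 ≤ c ∧ a ≠ b ∧
          Nonempty (G ≃g graphJoin (⊤ : SimpleGraph (Fin c))
            (disjUnionGraph (⊤ : SimpleGraph (Fin a)) (⊤ : SimpleGraph (Fin b))))) ∨
        (∃ t a c : ℕ, 2 ≤ t ∧ 1 ≤ a ∧ 1 ≤ c ∧
          Nonempty (G ≃g graphJoin (⊤ : SimpleGraph (Fin c)) (copiesComplete t a)))) := by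
  classical
  obtain ⟨z, hz⟩ := hz
  have hc : 1 ≤ (CC G).card := Finset.card_pos.mpr ⟨z, (mem_CC z).mpr hz⟩
  have hCC : Finset.univ.filter (fun x => nb G x = Finset.univ) = CC G := by
    ext x; simp [mem_CC]
  have adj : ∀ x y, G.Adj x y ↔ x ≠ y ∧
      (nb G x = nb G y ∨ nb G x = Finset.univ ∨ nb G y = Finset.univ) := by
    intro x y
    constructor
    · intro h
      refine ⟨h.ne, ?_⟩
      by_contra hh
      push Not at hh
      exact hh.1 (h1 x y hh.2.1 hh.2.2 ((mem_nb _ _ _).mpr (Or.inr h))).symm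
    · rintro ⟨hne, h⟩
      have : y ∈ nb G x := by
        rcases h with h | h | h
        · rw [h]; exact nb_self G y
        · rw [h]; simp
        · apply nb_symm; rw [h]; simp
      rcases (mem_nb _ _ _).mp this with h | h
      · exact (hne h.symm).elim
      · exact h
  have cls : ∀ u, nb G u ≠ Finset.univ →
      Finset.univ.filter (fun x => nb G x = nb G u) = nb G u \ CC G := by
    intro u hu
    ext x
    simp only [Finset.mem_filter, Finset.mem_univ, true_and, Finset.mem_sdiff, mem_CC]
    constructor
    · intro h; exact ⟨by rw [← h]; exact nb_self G x, by rw [h]; exact hu⟩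
    · rintro ⟨h, h'⟩; exact h1 u x hu h' h
  have clsc : ∀ u, nb G u ≠ Finset.univ →
      (Finset.univ.filter (fun x => nb G x = nb G u)).card + (CC G).card = (nb G u).card := by
    intro u hu
    rw [cls u hu]
    exact Finset.card_sdiff_add_card_eq_card (CC_sub u)
  have clsp : ∀ u, 1 ≤ (Finset.univ.filter (fun x => nb G x = nb G u)).card := by
    intro u
    exact Finset.card_pos.mpr ⟨u, by simp⟩
  obtain ⟨u0, hu0⟩ : ∃ u, nb G u ≠ Finset.univ := by
    by_contra hh
    push Not at hh
    obtain ⟨u, v, huv⟩ := h3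
    exact huv (by rw [kd_dom (hh u), kd_dom (hh v)])
  by_cases hreg : ∀ u v, nb G u ≠ Finset.univ → nb G v ≠ Finset.univ → kd G u = kd G v
  · right
    let κ := {s : Finset V // ∃ v, nb G v = s ∧ nb G v ≠ Finset.univ}
    let l : V → Option κ := fun v =>
      if h : nb G v = Finset.univ then none else some ⟨nb G v, v, rfl, h⟩
    have l0 : ∀ v, l v = none ↔ nb G v = Finset.univ := by
      intro v; simp only [l]; split_ifs with h <;> simp [h]
    have l1 : ∀ v (k : κ), l v = some k ↔ nb G v = k.1 := by
      rintro v ⟨s, w, rfl, hw⟩; simp only [l]; split_ifs with h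
      · simp [h]; exact fun h' => hw h'.symm
      · rw [Option.some_inj, Subtype.ext_iff]
    refine ⟨Fintype.card κ, (Finset.univ.filter (fun x => nb G x = nb G u0)).card, (CC G).card,
      ?_, clsp u0, hc, ?_⟩
    · obtain ⟨w, hw⟩ : ∃ w, w ∉ nb G u0 := by
        by_contra h
        push Not at h
        exact hu0 (Finset.eq_univ_of_forall h)
      have hwn : nb G w ≠ Finset.univ := by
        intro h; exact hw (nb_symm (by rw [h]; simp))
      apply Fintype.one_lt_card_iff.mpr
      refine ⟨⟨nb G u0, u0, rfl, hu0⟩, ⟨nb G w, w, rfl, hwn⟩, ?_⟩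
      intro h
      have h' : nb G u0 = nb G w := congrArg Subtype.val h
      exact hw (by rw [h']; exact nb_self G w)
    · let e := (Fintype.equivFin κ).symm
      apply iso_of_label G _ l (labB _ _ _ e) RR
      · intro x y
        rw [adj, RR, l0, l0]
        refine and_congr_right fun _ => ?_
        by_cases hy : nb G y = Finset.univ
        · simp [hy]
        · have : l y = some ⟨nb G y, y, rfl, hy⟩ := (l1 _ _).mpr rfl
          rw [this, l1]
      · exact adjB _ _ _ _ e.injective
      · intro k
        rcases k with _ | ⟨s, w, rfl, hw⟩
        · simp only [l0]
          rw [hCC, Finset.card_filter (fun y => labB _ _ _ e y = none), Fintype.sum_sum_type]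
          simp [labB]
        · simp only [l1]
          rw [Finset.card_filter (fun y => labB _ _ _ e y = some _), Fintype.sum_sum_type]
          have hk : (nb G w).card = (nb G u0).card := by
            have := hreg w u0 hw hu0
            unfold kd at this; exact_mod_cast this
          have a1 := clsc w hw
          have a2 := clsc u0 hu0
          have a3 : ∀ i, e i = ⟨nb G w, w, rfl, hw⟩ ↔ i = e.symm ⟨nb G w, w, rfl, hw⟩ :=
            fun i => e.eq_symm_apply.symm
          simp [labB, a3, fibc]
          omega
  · left
    push Not at hreg
    obtain ⟨u, v, hu, hv, huv⟩ := hreg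
    have hvu : v ∉ nb G u := by
      intro h
      apply huv
      unfold kd; rw [h1 u v hu hv h]
    have hcov := (h2 u v hu hv hvu).resolve_left huv
    let l : V → Option Bool := fun x =>
      if nb G x = Finset.univ then none else if nb G x = nb G u then some true else some false
    have hne : nb G v ≠ nb G u := fun h => hvu (by rw [← h]; exact nb_self G v)
    have tri : ∀ x, nb G x = Finset.univ ∨ nb G x = nb G u ∨ nb G x = nb G v := by
      intro x
      by_cases hx : nb G x = Finset.univ
      · exact Or.inl hx
      · right
        rcases hcov x with h | h
        · left; exact h1 u x hu hx h
        · right; exact h1 v x hv hx h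
    have l0 : ∀ x, l x = none ↔ nb G x = Finset.univ := by
      intro x; simp only [l]; split_ifs with h h' <;> simp [h]
    have l1 : ∀ x, l x = some true ↔ nb G x = nb G u := by
      intro x; simp only [l]
      rcases tri x with h | h | h <;> simp [h, hu, hv, hne, hu.symm]
    have l2 : ∀ x, l x = some false ↔ nb G x = nb G v := by
      intro x; simp only [l]
      rcases tri x with h | h | h <;> simp [h, hu, hv, hne, hv.symm, hne.symm]
    refine ⟨(Finset.univ.filter (fun x => nb G x = nb G u)).card,
      (Finset.univ.filter (fun x => nb G x = nb G v)).card, (CC G).card, clsp u, clsp v, hc, ?_, ?_⟩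
    · intro h
      apply huv
      have a1 := clsc u hu
      have a2 := clsc v hv
      have : (nb G u).card = (nb G v).card := by omega
      unfold kd; rw [this]
    · apply iso_of_label G _ l (labA _ _ _) RR
      · intro x y
        rw [adj, RR, l0, l0]
        refine and_congr_right fun _ => ?_
        rcases tri y with h | h | h
        · simp [h]
        · rw [(l1 y).mpr h, l1, h]
        · rw [(l2 y).mpr h, l2, h]
      · exact adjA _ _ _
      · intro k
        rcases k with _ | k
        · simp only [l0]
          rw [hCC, Finset.card_filter (fun y => labA _ _ _ y = none), Fintype.sum_sum_type, Fintype.sum_sum_type]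
          simp [labA]
        · cases k
          · simp only [l2]
            rw [Finset.card_filter (fun y => labA _ _ _ y = some _), Fintype.sum_sum_type, Fintype.sum_sum_type]
            simp [labA]
          · simp only [l1]
            rw [Finset.card_filter (fun y => labA _ _ _ y = some _), Fintype.sum_sum_type, Fintype.sum_sum_type]
            simp [labA]

end QTiso

theorem quasiThreshold_two_main_iff
    {V : Type*} [Fintype V] (G : SimpleGraph V)
    (hqt : IsQuasiThreshold G) (hconn : G.Connected) :
    mainQCount G = 2 ↔
      ((∃ a b c : ℕ, 1 ≤ a ∧ 1 ≤ b ∧ 1 ≤ c ∧ a ≠ b ∧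
          Nonempty (G ≃g graphJoin (⊤ : SimpleGraph (Fin c))
            (disjUnionGraph (⊤ : SimpleGraph (Fin a)) (⊤ : SimpleGraph (Fin b))))) ∨
        (∃ t a c : ℕ, 2 ≤ t ∧ 1 ≤ a ∧ 1 ≤ c ∧
          Nonempty (G ≃g graphJoin (⊤ : SimpleGraph (Fin c)) (copiesComplete t a)))) := by
  have := hconn.nonempty
  rw [star_count]
  constructor
  · rintro ⟨⟨α, β, hs⟩, h⟩
    obtain ⟨a1, a2, a3⟩ := structure_of_star hqt hconn hs
    exact iso_cases G a1 a2 a3 h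
  · rintro (⟨a, b, c, ha, hb, hc, _, ⟨e⟩⟩ | ⟨t, a, c, ht, ha, hc, ⟨e⟩⟩)
    · exact transport G _ e (starA a b c ha hb hc)
    · exact transport G _ e (starB t a c ht ha hc)
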